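/- Let G be a finite connected graph that is claw-free and bull-free. If G has independence number at least 3 (there exist three pairwise nonadjacent distinct vertices) and diameter exactly 2, then G contains an induced cycle of length 6. -/

import Mathlib

/-- A graph is claw-free: no induced `K_{1,3}`. -/
def ClawFree {V : Type*} (G : SimpleGraph V) : Prop :=
  ¬ ∃ v a b c : V, a ≠ b ∧ a ≠ c ∧ b ≠ c ∧
    G.Adj v a ∧ G.Adj v b ∧ G.Adj v c ∧ ¬ G.Adj a b ∧ ¬ G.Adj a c ∧ ¬ G.Adj b c

/-- A graph is bull-free: no induced bull (triangle `a b c` with pendants `d` at `a`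
and `e` at `b`). -/
def BullFree {V : Type*} (G : SimpleGraph V) : Prop :=
  ¬ ∃ a b c d e : V, a ≠ e ∧ b ≠ d ∧ c ≠ d ∧ c ≠ e ∧ d ≠ e ∧
    G.Adj a b ∧ G.Adj b c ∧ G.Adj c a ∧ G.Adj a d ∧ G.Adj b e ∧
    ¬ G.Adj b d ∧ ¬ G.Adj c d ∧ ¬ G.Adj a e ∧ ¬ G.Adj c e ∧ ¬ G.Adj d e
/-- `v : ZMod k → V` is an induced cycle of length `k` in `G`: the vertices are distinct and
two of them are adjacent iff their indices differ by `±1` modulo `k`. -/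
def IsInducedCycle {V : Type*} (G : SimpleGraph V) (k : ℕ) (v : ZMod k → V) : Prop :=
  Function.Injective v ∧ ∀ i j : ZMod k, G.Adj (v i) (v j) ↔ (i - j = 1 ∨ j - i = 1)

namespace SimpleGraph

variable {V : Type*} {G : SimpleGraph V}

/-- In a connected graph of diameter 2, nonadjacent distinct vertices have a common neighbor. -/
theorem exists_common_neighbor_of_diam_eq_two (hconn : G.Connected) (hdiam : G.diam = 2) {a b : V}
    (hne : a ≠ b) (hab : ¬ G.Adj a b) : ∃ x, G.Adj x a ∧ G.Adj x b := by
  have hle : G.dist a b ≤ 2 :=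
    hdiam ▸ dist_le_diam (ediam_ne_top_of_diam_ne_zero (by omega))
  obtain ⟨p, hp⟩ := hconn.exists_walk_length_eq_dist a b
  rw [← hp] at hle
  match p, hle with
  | .nil, _ => exact absurd rfl hne
  | .cons h .nil, _ => exact absurd h hab
  | .cons h (.cons h' .nil), _ => exact ⟨_, h.symm, h'⟩
  | .cons _ (.cons _ (.cons _ _)), hle => simp at hle

/-- In a bull-free graph, the midpoints `x` and `y` of two induced paths `a x b` and `b y c`
joining consecutive vertices of a stable set `a, b, c` are nonadjacent. -/
theorem not_adj_of_bullFree (hbull : BullFree G) {a b c x y : V} (hac : a ≠ c)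
    (hnab : ¬ G.Adj a b) (hnac : ¬ G.Adj a c) (hnbc : ¬ G.Adj b c)
    (hxa : G.Adj x a) (hxb : G.Adj x b) (hxc : ¬ G.Adj x c)
    (hya : ¬ G.Adj y a) (hyb : G.Adj y b) (hyc : G.Adj y c) : ¬ G.Adj x y := by
  intro hxy
  refine hbull ⟨x, y, b, a, c, ?_, ?_, ?_, ?_, hac, hxy, hyb, hxb.symm, hxa, hyc, hya,
    fun h => hnab h.symm, hxc, hnbc, hnac⟩
  · rintro rfl; exact hnac hxa.symm
  · rintro rfl; exact hnac hyc
  · rintro rfl; exact hya hyb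
  · rintro rfl; exact hxc hxb

end SimpleGraph

/-- A connected (claw, bull)-free graph with independence number at least 3 and diameter
exactly 2 contains an induced 6-cycle. -/
theorem inducedC6_of_diam_two {V : Type*} [Fintype V] (G : SimpleGraph V)
    (hconn : G.Connected) (hclaw : ClawFree G) (hbull : BullFree G)
    (hindep : ∃ a b c : V, a ≠ b ∧ a ≠ c ∧ b ≠ c ∧
      ¬ G.Adj a b ∧ ¬ G.Adj a c ∧ ¬ G.Adj b c)
    (hdiam : G.diam = 2) :
    ∃ v : ZMod 6 → V, IsInducedCycle G 6 v := by
  obtain ⟨a, b, c, hab, hac, hbc, hnab, hnac, hnbc⟩ := hindep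
  obtain ⟨x, hxa, hxb⟩ := G.exists_common_neighbor_of_diam_eq_two hconn hdiam hab hnab
  obtain ⟨y, hyb, hyc⟩ := G.exists_common_neighbor_of_diam_eq_two hconn hdiam hbc hnbc
  obtain ⟨z, hza, hzc⟩ := G.exists_common_neighbor_of_diam_eq_two hconn hdiam hac hnac
  have hxc : ¬ G.Adj x c := fun h =>
    hclaw ⟨x, a, b, c, hab, hac, hbc, hxa, hxb, h, hnab, hnac, hnbc⟩
  have hya : ¬ G.Adj y a := fun h =>
    hclaw ⟨y, a, b, c, hab, hac, hbc, h, hyb, hyc, hnab, hnac, hnbc⟩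
  have hzb : ¬ G.Adj z b := fun h =>
    hclaw ⟨z, a, b, c, hab, hac, hbc, hza, h, hzc, hnab, hnac, hnbc⟩
  have hnba : ¬ G.Adj b a := fun h => hnab h.symm
  have hnca : ¬ G.Adj c a := fun h => hnac h.symm
  have hxy : ¬ G.Adj x y :=
    SimpleGraph.not_adj_of_bullFree hbull hac hnab hnac hnbc hxa hxb hxc hya hyb hyc
  have hxz : ¬ G.Adj x z :=
    SimpleGraph.not_adj_of_bullFree hbull hbc hnba hnbc hnac hxb hxa hxc hzb hza hzc
  have hyz : ¬ G.Adj y z :=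
    SimpleGraph.not_adj_of_bullFree hbull hab.symm hnbc hnba hnca hyb hyc hya hzb hzc hza
  refine ⟨(![a, x, b, y, c, z] : Fin 6 → V), ?_, ?_⟩
  · change Function.Injective (![a, x, b, y, c, z] : Fin 6 → V)
    intro i j
    fin_cases i <;> fin_cases j <;> simp <;> grind [SimpleGraph.Adj.ne, SimpleGraph.adj_comm]
  · change ∀ i j : Fin 6, G.Adj (![a, x, b, y, c, z] i) (![a, x, b, y, c, z] j) ↔
      (i - j = 1 ∨ j - i = 1)
    intro i j
    fin_cases i <;> fin_cases j <;> simp <;> grind [SimpleGraph.adj_comm]
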